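/- The discrete Sobolev embedding ‖ |D_d|^{-3/8} f ‖_{ℓ⁸(ℤ)} ≲ ‖ f ‖_{ℓ²(ℤ)} holds, where |D_d|^{-3/8} is the discrete Fourier multiplier with symbol |sin θ|^{-3/8}. -/

import Mathlib

open MeasureTheory Real

/-- The convolution kernel of `|D_d|^{-3/8}`, i.e. the Fourier coefficients of
`|sin θ|^{-3/8}`. -/
noncomputable def Ker (m : ℤ) : ℂ :=
  (2 * π)⁻¹ • ∫ θ in (-π)..π,
    (|Real.sin θ| ^ (-(3 : ℝ) / 8) : ℝ) • Complex.exp (Complex.I * m * θ)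

lemma sing_int : IntervalIntegrable (fun θ : ℝ => |Real.sin θ| ^ (-(3 : ℝ) / 8)) volume (-π) π := by
  set g : ℝ → ℝ := fun θ : ℝ => |Real.sin θ| ^ (-(3 : ℝ) / 8) with hg
  have hpi := Real.pi_pos
  have h1 : IntervalIntegrable g volume 0 (π / 2) := by
    have h0 : IntervalIntegrable (fun θ : ℝ => (2 / π) ^ (-(3 : ℝ) / 8) * θ ^ (-(3 : ℝ) / 8)) volume 0 (π / 2) :=
      (intervalIntegral.intervalIntegrable_rpow' (by norm_num)).const_mul _
    refine h0.mono_fun' ?_ ?_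
    · have : Measurable g := by
        simp only [hg]; fun_prop
      exact this.aestronglyMeasurable
    · rw [Set.uIoc_of_le (by positivity)]
      refine (ae_restrict_iff' measurableSet_Ioc).2 (Filter.Eventually.of_forall ?_)
      intro x hx
      have hx0 := hx.1
      have h2 := Real.mul_le_sin hx.1.le hx.2
      have h3 : 0 < 2 / π * x := by positivity
      simp only [hg]
      rw [← Real.mul_rpow (by positivity) hx0.le]
      rw [Real.norm_of_nonneg (by positivity), abs_of_pos (by linarith)]
      exact Real.rpow_le_rpow_of_nonpos h3 h2 (by norm_num)
  have h2 : IntervalIntegrable g volume (-(π / 2)) 0 := by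
    have := (IntervalIntegrable.iff_comp_neg (f := g) (a := 0) (b := π / 2)).1 h1
    simp only [hg, Real.sin_neg, abs_neg, neg_zero] at this
    exact this.symm
  have h3 : IntervalIntegrable g volume (π / 2) π := by
    have := h2.comp_sub_right π
    simp only [hg, Real.sin_sub_pi, abs_neg] at this
    convert this using 1 <;> ring
  have h4 : IntervalIntegrable g volume (-π) (-(π / 2)) := by
    have := h1.comp_add_right π
    simp only [hg, Real.sin_add_pi, abs_neg] at this
    convert this using 1 <;> ring
  exact ((h4.trans h2).trans h1).trans h3

noncomputable def J (m : ℤ) : ℂ := ∫ θ in (-π)..π,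
    (|Real.sin θ| ^ (-(3 : ℝ) / 8) : ℝ) • Complex.exp (Complex.I * m * θ)

lemma J_int (m : ℤ) : IntervalIntegrable (fun θ : ℝ => 
    (|Real.sin θ| ^ (-(3 : ℝ) / 8) : ℝ) • Complex.exp (Complex.I * m * θ)) volume (-π) π := by
  apply sing_int.smul_continuousOn
  fun_prop

lemma J_neg (m : ℤ) : J (-m) = J m := by
  unfold J
  have := intervalIntegral.integral_comp_neg (a := -π) (b := π) (fun θ : ℝ => 
    (|Real.sin θ| ^ (-(3 : ℝ) / 8) : ℝ) • Complex.exp (Complex.I * m * θ))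
  rw [neg_neg] at this
  rw [← this]
  congr 1
  ext θ
  simp

lemma J_rec (m : ℤ) : ((m : ℂ) + 13 / 8) * J (m + 2) = ((m : ℂ) + 3 / 8) * J m := by
  have key := integral_eq_of_hasDerivAt_off_countable_of_le
    (fun θ : ℝ => ((|Real.sin θ| ^ (-(3 : ℝ) / 8) * Real.sin θ : ℝ) : ℂ) * Complex.exp (Complex.I * (m + 1) * θ))
    (fun θ : ℝ => (((m : ℂ) + 13 / 8) / 2) * ((|Real.sin θ| ^ (-(3 : ℝ) / 8) : ℝ) • Complex.exp (Complex.I * (m + 2 : ℤ) * θ))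
      - (((m : ℂ) + 3 / 8) / 2) * ((|Real.sin θ| ^ (-(3 : ℝ) / 8) : ℝ) • Complex.exp (Complex.I * m * θ)))
    (a := -π) (b := π) (by linarith [Real.pi_pos]) (s := {0}) (Set.countable_singleton 0)
    ?_ ?_ (((J_int (m+2)).const_mul _).sub ((J_int m).const_mul _))
  · rw [intervalIntegral.integral_sub ((J_int (m+2)).const_mul _) ((J_int m).const_mul _),
      intervalIntegral.integral_const_mul, intervalIntegral.integral_const_mul] at key
    change _ / 2 * J (m+2) - _ / 2 * J m = _ at key
    simp at key
    linear_combination 2 * key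
  · apply Continuous.continuousOn
    apply Continuous.mul _ (by fun_prop)
    apply Complex.continuous_ofReal.comp
    have h1 : Continuous (fun s : ℝ => |s| ^ (-(3 : ℝ) / 8) * s) := by
      rw [continuous_iff_continuousAt]
      intro s
      by_cases hs : s = 0
      · subst hs
        unfold ContinuousAt
        simp only [mul_zero]
        apply squeeze_zero_norm (a := fun s : ℝ => |s| ^ ((5 : ℝ) / 8))
        · intro t
          by_cases ht : t = 0
          · subst ht; simp
          · rw [norm_mul, Real.norm_of_nonneg (by positivity), Real.norm_eq_abs]
            have := abs_pos.2 ht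
            rw [← Real.rpow_add_one this.ne']
            norm_num
        · have : Continuous (fun s : ℝ => |s| ^ ((5 : ℝ) / 8)) := by
            apply Continuous.rpow_const continuous_abs
            intro x; right; norm_num
          have := this.tendsto 0
          simpa using this
      · apply ContinuousAt.mul _ continuousAt_id
        apply ContinuousAt.rpow_const (by fun_prop)
        left; simpa using hs
    exact h1.comp Real.continuous_sin
  · rintro x ⟨hx, hx0⟩
    have hs : Real.sin x ≠ 0 := by
      intro h
      exact hx0 ((Real.sin_eq_zero_iff_of_lt_of_lt hx.1 hx.2).1 h)
    have d1 : HasDerivAt (fun s : ℝ => |s| ^ (-(3 : ℝ) / 8) * s) ((5 / 8) * |Real.sin x| ^ (-(3 : ℝ) / 8)) (Real.sin x) := by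
      have hp := abs_pos.2 hs
      have d0 := ((hasDerivAt_abs hs).rpow_const (p := -(3 : ℝ) / 8) (Or.inl hp.ne')).mul (hasDerivAt_id (Real.sin x))
      refine d0.congr_deriv ?_
      have e : |Real.sin x| ^ (-(3 : ℝ) / 8) = |Real.sin x| ^ (-(3 : ℝ) / 8 - 1) * |Real.sin x| := by
        rw [← Real.rpow_add_one hp.ne']; norm_num
      have e2 : ((SignType.sign (Real.sin x) : SignType) : ℝ) * Real.sin x = |Real.sin x| := sign_mul_self _
      simp only [id]
      rw [e]
      linear_combination (-(3:ℝ)/8) * |Real.sin x| ^ (-(3 : ℝ) / 8 - 1) * e2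
    have d2 := (d1.comp x (Real.hasDerivAt_sin x)).ofReal_comp
    have d3 : HasDerivAt (fun θ : ℝ => Complex.exp (Complex.I * (m + 1) * θ))
        (Complex.exp (Complex.I * (m + 1) * x) * (Complex.I * (m + 1) * 1)) x := by
      have := ((hasDerivAt_id (x : ℂ)).const_mul (Complex.I * (m + 1))).cexp.comp_ofReal
      simpa using this
    refine (d2.mul d3).congr_deriv ?_
    have e1 : Complex.exp (Complex.I * (m + 2 : ℤ) * x) = Complex.exp (Complex.I * (m + 1) * x) * Complex.exp (x * Complex.I) := by
      rw [← Complex.exp_add]; congr 1; push_cast; ring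
    have e2 : Complex.exp (Complex.I * m * x) = Complex.exp (Complex.I * (m + 1) * x) * Complex.exp (-(x * Complex.I)) := by
      rw [← Complex.exp_add]; congr 1; ring
    rw [e1, e2, ← neg_mul, Complex.exp_mul_I, Complex.exp_mul_I, Complex.cos_neg, Complex.sin_neg]
    simp only [Complex.real_smul, Function.comp]
    push_cast
    ring_nf

lemma Ker_bound : ∃ C > 0, ∀ m : ℤ, ‖Ker m‖ ≤ C * (1 + (m.natAbs : ℝ)) ^ (-(5 : ℝ) / 8) := by
  have hJ : ∃ C > 0, ∀ m : ℕ, ‖J m‖ ≤ C * (1 + (m : ℝ)) ^ (-(5 : ℝ) / 8) := by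
    refine ⟨‖J 0‖ + ‖J 1‖ * 2 ^ ((5 : ℝ) / 8) + 1, by positivity, ?_⟩
    set C := ‖J 0‖ + ‖J 1‖ * 2 ^ ((5 : ℝ) / 8) + 1 with hC
    have hC0 : 0 < C := by positivity
    intro m
    induction m using Nat.twoStepInduction with
    | zero => 
      simp only [hC, Nat.cast_zero, add_zero, Real.one_rpow, mul_one]
      have : 0 ≤ ‖J 1‖ * 2 ^ ((5 : ℝ) / 8) := by positivity
      linarith
    | one =>
      simp only [Nat.cast_one]
      rw [show (1 + 1 : ℝ) = 2 by norm_num, show (-(5 : ℝ) / 8) = -(5 / 8) by norm_num, Real.rpow_neg (by norm_num),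
        ← div_eq_mul_inv, le_div_iff₀ (by positivity)]
      simp only [hC]
      have := norm_nonneg (J 0)
      linarith
    | more m ih _ =>
      have h := congrArg norm (J_rec m)
      rw [norm_mul, norm_mul] at h
      have n1 : ‖(((m : ℕ) : ℤ) : ℂ) + 13 / 8‖ = (m : ℝ) + 13 / 8 := by
        rw [show ((((m : ℕ) : ℤ) : ℂ) + 13 / 8) = (((m : ℝ) + 13 / 8 : ℝ) : ℂ) by push_cast; rfl]
        rw [Complex.norm_real, Real.norm_of_nonneg (by positivity)]
      have n2 : ‖(((m : ℕ) : ℤ) : ℂ) + 3 / 8‖ = (m : ℝ) + 3 / 8 := by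
        rw [show ((((m : ℕ) : ℤ) : ℂ) + 3 / 8) = (((m : ℝ) + 3 / 8 : ℝ) : ℂ) by push_cast; rfl]
        rw [Complex.norm_real, Real.norm_of_nonneg (by positivity)]
      rw [n1, n2] at h
      push_cast
      have hm : (0:ℝ) ≤ m := by positivity
      have hs1 : -1 ≤ 2 / (1 + (m:ℝ)) := by
        have : 0 ≤ 2 / (1 + (m:ℝ)) := by positivity
        linarith
      have b := rpow_one_add_le_one_add_mul_self (s := 2 / (1 + (m:ℝ))) hs1
        (p := 5 / 8) (by norm_num) (by norm_num)
      have e : 1 + 2 / (1 + (m:ℝ)) = (1 + (m + 2)) / (1 + m) := by field_simp; ring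
      rw [e, Real.div_rpow (by positivity) (by positivity)] at b
      rw [show (-(5 : ℝ) / 8) = -(5 / 8) by norm_num, Real.rpow_neg (by positivity), ← div_eq_mul_inv] at ih ⊢
      set P := (1 + (m:ℝ)) ^ ((5:ℝ)/8)
      set P' := (1 + ((m:ℝ) + 2)) ^ ((5:ℝ)/8)
      have hP : 0 < P := by positivity
      have hP' : 0 < P' := by positivity
      rw [le_div_iff₀ hP] at ih
      rw [le_div_iff₀ hP']
      have b2 : P' / P ≤ (m + 13 / 8) / (m + 3 / 8) := by
        refine b.trans ?_
        rw [le_div_iff₀ (by positivity)]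
        have : 5 / 8 * (2 / (1 + (m:ℝ))) * (m + 3/8) ≤ 5 / 4 := by
          rw [show 5 / 8 * (2 / (1 + (m:ℝ))) * (m + 3/8) = 5 / 4 * ((m + 3/8) / (1 + m)) by ring]
          have : ((m:ℝ) + 3/8) / (1 + m) ≤ 1 := by
            rw [div_le_one (by positivity)]; linarith
          linarith
        linarith
      rw [div_le_div_iff₀ hP (by positivity)] at b2
      have hpos : 0 < (m : ℝ) + 13 / 8 := by positivity
      refine le_of_mul_le_mul_left ?_ hpos
      calc ((m:ℝ) + 13/8) * (‖J (m + 2)‖ * P') = (P' * (m + 3/8)) * ‖J m‖ := by rw [← mul_assoc, h]; ring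
        _ ≤ ((m + 13/8) * P) * ‖J m‖ := by gcongr
        _ = (m + 13/8) * (‖J m‖ * P) := by ring
        _ ≤ _ := by gcongr
  obtain ⟨C, hC, h⟩ := hJ
  refine ⟨(2 * π)⁻¹ * C, by positivity, fun m => ?_⟩
  have e : Ker m = (2 * π)⁻¹ • J m := rfl
  rw [e, norm_smul, Real.norm_of_nonneg (by positivity), mul_assoc]
  gcongr
  have h1 := h m.natAbs
  rcases Int.natAbs_eq m with h2 | h2
  · rwa [← h2] at h1
  · rw [h2, J_neg, Int.natAbs_neg, Int.natAbs_natCast]; exact h1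

/-- averaging kernel -/
noncomputable def av (r : ℕ) (d : ℤ) : ℝ := if d.natAbs ≤ r then (1 : ℝ) / (2 * r + 1) else 0

lemma av_nonneg (r : ℕ) (d : ℤ) : 0 ≤ av r d := by
  unfold av; split_ifs <;> positivity

lemma shell_card (S : Finset ℤ) (n : ℤ) (k : ℕ) :
    (S.filter (fun m => (n - m).natAbs = k)).card ≤ 2 := by
  refine (Finset.card_le_card (t := {n - k, n + k}) ?_).trans Finset.card_le_two
  intro m hm
  simp only [Finset.mem_filter, Finset.mem_insert, Finset.mem_singleton] at hm ⊢
  omega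

lemma filter_succ (S : Finset ℤ) (n : ℤ) (k : ℕ) (F : ℤ → ℝ) :
    ∑ m ∈ S with (n - m).natAbs ≤ k + 1, F m = ∑ m ∈ S with (n - m).natAbs ≤ k, F m
      + ∑ m ∈ S with (n - m).natAbs = k + 1, F m := by
  rw [← Finset.sum_union]
  · congr 1
    ext m
    simp only [Finset.mem_filter, Finset.mem_union]
    constructor
    · rintro ⟨a, b⟩
      rcases Nat.le_succ_iff.1 b with h | h
      · exact Or.inl ⟨a, h⟩
      · exact Or.inr ⟨a, h⟩
    · rintro (⟨a, b⟩ | ⟨a, b⟩)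
      · exact ⟨a, by omega⟩
      · exact ⟨a, by omega⟩
  · rw [Finset.disjoint_left]
    intro m h1 h2
    simp only [Finset.mem_filter] at h1 h2
    omega

lemma ball_card (S : Finset ℤ) (n : ℤ) (k : ℕ) :
    ∑ m ∈ S with (n - m).natAbs ≤ k, (1 : ℝ) ≤ 2 * k + 1 := by
  induction k with
  | zero =>
    rw [Finset.sum_const, nsmul_eq_mul, mul_one]
    have : (S.filter (fun m => (n - m).natAbs ≤ 0)).card ≤ 1 := by
      refine (Finset.card_le_card (t := {n}) ?_)
      intro m hm
      simp only [Finset.mem_filter, Finset.mem_singleton] at hm ⊢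
      omega
    have h : ((S.filter (fun m => (n - m).natAbs ≤ 0)).card : ℝ) ≤ 1 := by exact_mod_cast this
    simpa using h
  | succ k ih =>
    rw [filter_succ]
    have h : ((S.filter (fun m => (n - m).natAbs = k + 1)).card : ℝ) ≤ 2 := by
      exact_mod_cast shell_card S n (k+1)
    have e : ∑ m ∈ S with (n - m).natAbs = k + 1, (1 : ℝ) = ((S.filter (fun m => (n - m).natAbs = k + 1)).card : ℝ) := by
      simp
    rw [e]
    push_cast
    linarith

lemma av_sum (S : Finset ℤ) (n : ℤ) (r : ℕ) : ∑ m ∈ S, av r (n - m) ≤ 1 := by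
  have h := ball_card S n r
  unfold av
  rw [← Finset.sum_filter]
  have : ∑ m ∈ S with (n - m).natAbs ≤ r, (1:ℝ) / (2 * r + 1)
      = (∑ m ∈ S with (n - m).natAbs ≤ r, (1:ℝ)) / (2 * r + 1) := by
    rw [Finset.sum_div]
  rw [this, div_le_one (by positivity)]
  exact h

lemma av_mul_aux (S : Finset ℤ) (n n' : ℤ) (r r' : ℕ) (h : r' ≤ r) :
    ∑ m ∈ S, av r (n - m) * av r' (n' - m) ≤ 2 * av (2 * r) (n - n') := by
  by_cases hd : (n - n').natAbs ≤ 2 * r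
  · have e : av (2 * r) (n - n') = 1 / (2 * ((2 * r : ℕ) : ℝ) + 1) := by unfold av; rw [if_pos hd]
    rw [e]
    calc ∑ m ∈ S, av r (n - m) * av r' (n' - m) ≤ ∑ m ∈ S, 1 / (2 * r + 1) * av r' (n' - m) := by
          refine Finset.sum_le_sum fun m _ => ?_
          refine mul_le_mul_of_nonneg_right ?_ (av_nonneg _ _)
          unfold av; split_ifs
          · exact le_rfl
          · positivity
      _ = 1 / (2 * r + 1) * ∑ m ∈ S, av r' (n' - m) := by rw [Finset.mul_sum]
      _ ≤ 1 / (2 * r + 1) * 1 := by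
          refine mul_le_mul_of_nonneg_left (av_sum _ _ _) (by positivity)
      _ ≤ _ := by
          push_cast
          rw [mul_one, mul_one_div, div_le_div_iff₀ (by positivity) (by positivity)]
          have : (0:ℝ) ≤ r := by positivity
          linarith
  · have e : av (2 * r) (n - n') = 0 := by unfold av; rw [if_neg hd]
    rw [e, mul_zero]
    refine (Finset.sum_eq_zero fun m _ => ?_).le
    unfold av
    split_ifs with h1 h2
    · omega
    all_goals simp

lemma av_mul (S : Finset ℤ) (n n' : ℤ) (r r' : ℕ) :
    ∑ m ∈ S, av r (n - m) * av r' (n' - m) ≤ 2 * av (2 * r) (n - n') + 2 * av (2 * r') (n' - n) := by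
  rcases le_total r' r with h | h
  · have := av_mul_aux S n n' r r' h
    have := av_nonneg (2 * r') (n' - n)
    linarith
  · have h1 := av_mul_aux S n' n r' r h
    have := av_nonneg (2 * r) (n - n')
    have e : ∑ m ∈ S, av r (n - m) * av r' (n' - m) = ∑ m ∈ S, av r' (n' - m) * av r (n - m) :=
      Finset.sum_congr rfl fun m _ => mul_comm _ _
    linarith

def PB (S : Finset ℤ) (B : ℝ) : Prop := ∀ (r : ℤ → ℕ) (f : ℤ → ℝ), (∀ m, 0 ≤ f m) →
  ∑ n ∈ S, (∑ m ∈ S, av (r n) (n - m) * f m) ^ 2 ≤ B * ∑ m ∈ S, f m ^ 2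

lemma PB_step (S : Finset ℤ) (B : ℝ) (hB : 0 ≤ B) (h : PB S B) : PB S (4 * √B) := by
  intro r f hf
  set g : ℤ → ℝ := fun n => ∑ m ∈ S, av (r n) (n - m) * f m with hg
  have hg0 : ∀ n, 0 ≤ g n := fun n => Finset.sum_nonneg fun m _ => mul_nonneg (av_nonneg _ _) (hf m)
  set G := ∑ n ∈ S, g n ^ 2 with hG
  set Q := ∑ m ∈ S, f m ^ 2 with hQ
  have hG0 : 0 ≤ G := Finset.sum_nonneg fun _ _ => sq_nonneg _
  have hQ0 : 0 ≤ Q := Finset.sum_nonneg fun _ _ => sq_nonneg _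
  set a : ℤ → ℝ := fun m => ∑ n ∈ S, av (r n) (n - m) * g n with ha
  have e1 : G = ∑ m ∈ S, f m * a m := by
    simp only [hG, ha, sq]
    simp only [Finset.mul_sum]
    rw [Finset.sum_comm]
    refine Finset.sum_congr rfl fun n _ => ?_
    conv_lhs => rw [hg]
    simp only
    rw [Finset.sum_mul]
    refine Finset.sum_congr rfl fun m _ => ?_
    simp only [hg]; ring
  have cs := Finset.sum_mul_sq_le_sq_mul_sq S f a
  rw [← e1] at cs
  set q : ℝ := ∑ n ∈ S, g n * ∑ n' ∈ S, av (2 * r n) (n - n') * g n' with hq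
  have e2 : ∑ m ∈ S, a m ^ 2 ≤ 4 * q := by
    have e3 : ∑ m ∈ S, a m ^ 2 = ∑ n ∈ S, ∑ n' ∈ S, g n * g n' * ∑ m ∈ S, av (r n) (n - m) * av (r n') (n' - m) := by
      simp only [ha, sq, Finset.sum_mul_sum]
      rw [Finset.sum_comm]
      refine Finset.sum_congr rfl fun n _ => ?_
      rw [Finset.sum_comm]
      refine Finset.sum_congr rfl fun n' _ => ?_
      rw [Finset.mul_sum]
      refine Finset.sum_congr rfl fun m _ => ?_
      ring
    rw [e3]
    calc _ ≤ ∑ n ∈ S, ∑ n' ∈ S, g n * g n' * (2 * av (2 * r n) (n - n') + 2 * av (2 * r n') (n' - n)) := by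
          refine Finset.sum_le_sum fun n _ => Finset.sum_le_sum fun n' _ => ?_
          exact mul_le_mul_of_nonneg_left (av_mul _ _ _ _ _) (mul_nonneg (hg0 _) (hg0 _))
      _ = ∑ n ∈ S, ∑ n' ∈ S, g n * g n' * (2 * av (2 * r n) (n - n')) + ∑ n ∈ S, ∑ n' ∈ S, g n * g n' * (2 * av (2 * r n') (n' - n)) := by
          simp only [mul_add, Finset.sum_add_distrib]
      _ = ∑ n ∈ S, ∑ n' ∈ S, g n * g n' * (2 * av (2 * r n) (n - n')) + ∑ n ∈ S, ∑ n' ∈ S, g n' * g n * (2 * av (2 * r n) (n - n')) := by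
          congr 1
          rw [Finset.sum_comm]
      _ = 4 * q := by
          simp only [hq, Finset.mul_sum, ← Finset.sum_add_distrib]
          refine Finset.sum_congr rfl fun n _ => Finset.sum_congr rfl fun n' _ => ?_
          ring
  have e4 : q ≤ √B * G := by
    have c2 := Finset.sum_mul_sq_le_sq_mul_sq S g (fun n => ∑ n' ∈ S, av (2 * r n) (n - n') * g n')
    have c3 := h (fun n => 2 * r n) g hg0
    refine abs_le_of_sq_le_sq' ?_ (by positivity) |>.2
    calc q ^ 2 ≤ G * _ := c2
      _ ≤ G * (B * G) := by gcongr
      _ = (√B * G) ^ 2 := by rw [mul_pow, Real.sq_sqrt hB]; ring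
  change G ≤ _
  by_cases hz : G = 0
  · rw [hz]; positivity
  have hGp : 0 < G := lt_of_le_of_ne hG0 (Ne.symm hz)
  refine le_of_mul_le_mul_left ?_ hGp
  calc G * G = G ^ 2 := by ring
    _ ≤ Q * _ := cs
    _ ≤ Q * (4 * (√B * G)) := by gcongr; linarith
    _ = _ := by ring

lemma PB16 (S : Finset ℤ) : PB S 16 := by
  have h0 : PB S (S.card) := by
    intro r f hf
    calc _ ≤ ∑ n ∈ S, ∑ m ∈ S, f m ^ 2 := by
          refine Finset.sum_le_sum fun n _ => ?_
          refine (Finset.sum_mul_sq_le_sq_mul_sq S (fun m => av (r n) (n - m)) f).trans ?_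
          have : ∑ m ∈ S, av (r n) (n - m) ^ 2 ≤ 1 := by
            refine le_trans (Finset.sum_le_sum fun m _ => ?_) (av_sum S n (r n))
            have a1 := av_nonneg (r n) (n - m)
            have a2 : av (r n) (n - m) ≤ 1 := by
              unfold av; split_ifs
              · rw [div_le_one (by positivity)]
                have : (0:ℝ) ≤ r n := by positivity
                linarith
              · norm_num
            nlinarith
          exact mul_le_of_le_one_left (Finset.sum_nonneg fun _ _ => sq_nonneg _) this
      _ = _ := by simp
  set X := {B : ℝ | 0 ≤ B ∧ PB S B} with hX
  have hne : X.Nonempty := ⟨_, by positivity, h0⟩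
  have hbd : BddBelow X := ⟨0, fun B hB => hB.1⟩
  have hcl : IsClosed X := by
    have : X = Set.Ici 0 ∩ ⋂ (r : ℤ → ℕ) (f : ℤ → ℝ) (_ : ∀ m, 0 ≤ f m), {B : ℝ | ∑ n ∈ S, (∑ m ∈ S, av (r n) (n - m) * f m) ^ 2 ≤ B * ∑ m ∈ S, f m ^ 2} := by
      ext B; simp [hX, PB]
    rw [this]
    refine isClosed_Ici.inter (isClosed_iInter fun r => isClosed_iInter fun f => isClosed_iInter fun _ => ?_)
    exact isClosed_le continuous_const (by fun_prop)
  have hm := hcl.csInf_mem hne hbd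
  set b := sInf X
  have hle : b ≤ 4 * √b := csInf_le hbd ⟨by positivity, PB_step S b hm.1 hm.2⟩
  have hb : b ≤ 16 := by
    have h1 := Real.sq_sqrt hm.1
    have h2 := Real.sqrt_nonneg b
    by_contra hc
    push Not at hc
    have : 4 < √b := Real.lt_sqrt_of_sq_lt (by linarith)
    nlinarith
  intro r f hf
  refine (hm.2 r f hf).trans ?_
  gcongr

noncomputable def ww (k : ℕ) : ℝ := (1 + (k : ℝ)) ^ (-(5 : ℝ) / 8)

lemma ww_pos (k : ℕ) : 0 < ww k := by unfold ww; positivity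

lemma bern {x p : ℝ} (hx : 1 ≤ x) (hp : 0 ≤ p) (hp1 : p ≤ 1) :
    (x - 1) ^ p ≤ x ^ p * (1 - p / x) := by
  have hx0 : 0 < x := by linarith
  have hinv : 1 / x ≤ 1 := by rw [div_le_one hx0]; exact hx
  have b := rpow_one_add_le_one_add_mul_self (s := -(1 / x)) (by linarith) hp hp1
  have e : x - 1 = x * (1 + -(1 / x)) := by field_simp; ring
  rw [e, Real.mul_rpow hx0.le (by linarith)]
  refine mul_le_mul_of_nonneg_left (b.trans (le_of_eq ?_)) (by positivity)
  ring

lemma ww_near (k : ℕ) : 2 * ww (k + 1) ≤ 16 / 3 * ((k + 2 : ℝ) ^ ((3 : ℝ) / 8) - (k + 1 : ℝ) ^ ((3 : ℝ) / 8)) := by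
  have hx : (1 : ℝ) ≤ k + 2 := by have : (0:ℝ) ≤ k := by positivity
                                  linarith
  have b := bern (x := k + 2) (p := 3 / 8) hx (by norm_num) (by norm_num)
  rw [show (k + 2 - 1 : ℝ) = k + 1 by ring] at b
  unfold ww
  push_cast
  rw [show (1 + (k + 1) : ℝ) = k + 2 by ring, show (-(5 : ℝ) / 8) = 3 / 8 - 1 by norm_num,
    Real.rpow_sub_one (by positivity)]
  have e : (k + 2 : ℝ) ^ ((3 : ℝ) / 8) * (1 - 3 / 8 / (k + 2)) = (k + 2 : ℝ) ^ ((3 : ℝ) / 8)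
    - 3 / 8 * ((k + 2 : ℝ) ^ ((3 : ℝ) / 8) / (k + 2)) := by ring
  rw [e] at b
  linarith

lemma ww_far (k : ℕ) : 2 * ww (k + 1) ^ 2 ≤ 8 * ((k + 1 : ℝ) ^ (-(1 : ℝ) / 4) - (k + 2 : ℝ) ^ (-(1 : ℝ) / 4)) := by
  have hx : (1 : ℝ) ≤ k + 2 := by have : (0:ℝ) ≤ k := by positivity
                                  linarith
  have b := bern (x := k + 2) (p := 1 / 4) hx (by norm_num) (by norm_num)
  rw [show (k + 2 - 1 : ℝ) = k + 1 by ring] at b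
  have e : ww (k + 1) ^ 2 = (k + 2 : ℝ) ^ (-(1 : ℝ) / 4) / (k + 2) := by
    unfold ww
    push_cast
    rw [show (1 + (k + 1) : ℝ) = k + 2 by ring, ← Real.rpow_natCast, ← Real.rpow_mul (by positivity),
      ← Real.rpow_sub_one (by positivity)]
    norm_num
  rw [e]
  rw [show (-(1 : ℝ) / 4) = -(1 / 4) by norm_num, Real.rpow_neg (by positivity), Real.rpow_neg (by positivity)]
  set P := (k + 2 : ℝ) ^ ((1 : ℝ) / 4)
  set P' := (k + 1 : ℝ) ^ ((1 : ℝ) / 4)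
  have hP : 0 < P := by positivity
  have hP' : 0 < P' := by positivity
  have hk : (0 : ℝ) < k + 2 := by positivity
  have h1 : P⁻¹ * (1 + 1 / 4 / (k + 2)) ≤ P'⁻¹ := by
    rw [← one_div, ← one_div, le_div_iff₀ hP', mul_comm, ← mul_assoc]
    have : P' * (1 / P) ≤ 1 - 1 / 4 / (k + 2) := by
      rw [mul_one_div, div_le_iff₀ hP]; linarith
    have h2 : (0:ℝ) ≤ 1 / 4 / (k + 2) := by positivity
    nlinarith
  have h3 : P⁻¹ * (1 + 1 / 4 / (k + 2)) = P⁻¹ + 1 / 4 * (P⁻¹ / (k + 2)) := by ring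
  rw [h3] at h1
  linarith

lemma ww_anti (k : ℕ) : ww (k + 1) ≤ ww k := by
  unfold ww
  apply Real.rpow_le_rpow_of_nonpos (by positivity) _ (by norm_num)
  push_cast; linarith

lemma near_sum (S : Finset ℤ) (n : ℤ) (f : ℤ → ℝ) (M : ℝ) (R : ℕ)
    (hM0 : 0 ≤ M)
    (hM : ∀ r ≤ R, ∑ m ∈ S with (n - m).natAbs ≤ r, f m ≤ M * (2 * r + 1)) :
    ∑ m ∈ S with (n - m).natAbs ≤ R, ww (n - m).natAbs * f m
      ≤ M * (16 / 3 * (R + 1 : ℝ) ^ ((3 : ℝ) / 8)) := by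
  have key : ∑ m ∈ S with (n - m).natAbs ≤ R, ww (n - m).natAbs * f m
      + ww R * (M * (2 * R + 1) - ∑ m ∈ S with (n - m).natAbs ≤ R, f m)
      ≤ M * (16 / 3 * (R + 1 : ℝ) ^ ((3 : ℝ) / 8)) := by
    induction R with
    | zero =>
      have e : ∑ m ∈ S with (n - m).natAbs ≤ 0, ww (n - m).natAbs * f m
          = ww 0 * ∑ m ∈ S with (n - m).natAbs ≤ 0, f m := by
        rw [Finset.mul_sum]
        refine Finset.sum_congr rfl fun m hm => ?_
        rw [Nat.le_zero.1 (Finset.mem_filter.1 hm).2]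
      rw [e]
      have : ww 0 = 1 := by simp [ww]
      rw [this]
      simp
      linarith
    | succ R ih =>
      have ih := ih fun r hr => hM r (by omega)
      have hMR := hM R (by omega)
      rw [filter_succ, filter_succ]
      have e : ∑ m ∈ S with (n - m).natAbs = R + 1, ww (n - m).natAbs * f m
          = ww (R + 1) * ∑ m ∈ S with (n - m).natAbs = R + 1, f m := by
        rw [Finset.mul_sum]
        refine Finset.sum_congr rfl fun m hm => ?_
        rw [(Finset.mem_filter.1 hm).2]
      rw [e]
      have h1 := mul_le_mul_of_nonneg_right (ww_anti R) (sub_nonneg.2 hMR)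
      have h2 := mul_le_mul_of_nonneg_left (ww_near R) hM0
      push_cast
      rw [show (R + 1 + 1 : ℝ) = R + 2 by ring]
      nlinarith
  have := mul_nonneg (ww_pos R).le (sub_nonneg.2 (hM R le_rfl))
  linarith

lemma far_sum (S : Finset ℤ) (n : ℤ) (R : ℕ) :
    ∑ m ∈ S with ¬ (n - m).natAbs ≤ R, ww (n - m).natAbs ^ 2 ≤ 8 * (R + 1 : ℝ) ^ (-(1 : ℝ) / 4) := by
  have key : ∀ L : ℕ, ∑ m ∈ S.filter (fun m => ¬ (n - m).natAbs ≤ R) with (n - m).natAbs ≤ R + L, ww (n - m).natAbs ^ 2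
      ≤ 8 * ((R + 1 : ℝ) ^ (-(1 : ℝ) / 4) - (R + L + 1 : ℝ) ^ (-(1 : ℝ) / 4)) := by
    intro L
    induction L with
    | zero =>
      simp only [add_zero, Nat.cast_zero, sub_self, mul_zero]
      refine (Finset.sum_eq_zero fun m hm => ?_).le
      simp only [Finset.mem_filter] at hm
      omega
    | succ L ih =>
      rw [← add_assoc, filter_succ]
      have h1 : ∑ m ∈ S.filter (fun m => ¬ (n - m).natAbs ≤ R) with (n - m).natAbs = R + L + 1, ww (n - m).natAbs ^ 2
          ≤ 2 * ww (R + L + 1) ^ 2 := by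
        have e : ∑ m ∈ S.filter (fun m => ¬ (n - m).natAbs ≤ R) with (n - m).natAbs = R + L + 1, ww (n - m).natAbs ^ 2
          = ∑ m ∈ S.filter (fun m => ¬ (n - m).natAbs ≤ R) with (n - m).natAbs = R + L + 1, ww (R + L + 1) ^ 2 :=
          Finset.sum_congr rfl fun m hm => by rw [(Finset.mem_filter.1 hm).2]
        rw [e, Finset.sum_const, nsmul_eq_mul]
        refine mul_le_mul_of_nonneg_right ?_ (sq_nonneg _)
        exact_mod_cast shell_card _ n _
      have h2 := ww_far (R + L)
      push_cast at h2 ⊢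
      rw [show (R + (L + 1) + 1 : ℝ) = R + L + 2 by ring]
      linarith
  have := key (∑ m ∈ S, (n - m).natAbs)
  rw [Finset.filter_true_of_mem] at this
  · refine this.trans ?_
    have : (0:ℝ) ≤ (R + (∑ m ∈ S, (n - m).natAbs : ℕ) + 1 : ℝ) ^ (-(1 : ℝ) / 4) := by positivity
    linarith
  · intro m hm
    have h := Finset.single_le_sum (f := fun m => (n - m).natAbs) (fun _ _ => Nat.zero_le _) (Finset.mem_filter.1 hm).1
    omega

lemma all_sum (S : Finset ℤ) (n : ℤ) : ∑ m ∈ S, ww (n - m).natAbs ^ 2 ≤ 9 := by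
  have h := far_sum S n 0
  rw [← Finset.sum_filter_add_sum_filter_not S (fun m => (n - m).natAbs ≤ 0)]
  have h2 : ∑ m ∈ S with (n - m).natAbs ≤ 0, ww (n - m).natAbs ^ 2 ≤ 1 := by
    have := ball_card S n 0
    refine le_trans (Finset.sum_le_sum fun m hm => ?_) (this.trans (by simp))
    rw [Nat.le_zero.1 (Finset.mem_filter.1 hm).2]
    simp [ww]
  simp at h h2 ⊢
  linarith

lemma pointwise (S : Finset ℤ) (n : ℤ) (f : ℤ → ℝ) (hf : ∀ m, 0 ≤ f m) :
    ∃ r : ℕ, (∑ m ∈ S, ww (n - m).natAbs * f m) ^ 8 ≤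
      456 * 36 ^ 3 * (∑ m ∈ S, f m ^ 2) ^ 3 * (∑ m ∈ S, av r (n - m) * f m) ^ 2 := by
  set F := ∑ m ∈ S, ww (n - m).natAbs * f m with hF
  set Q := ∑ m ∈ S, f m ^ 2 with hQ
  have hQ0 : 0 ≤ Q := Finset.sum_nonneg fun _ _ => sq_nonneg _
  have hF0 : 0 ≤ F := Finset.sum_nonneg fun m _ => mul_nonneg (ww_pos _).le (hf m)
  by_cases hz : F = 0
  · refine ⟨0, ?_⟩
    rw [hz, zero_pow (by norm_num)]; positivity
  have hFp : 0 < F := lt_of_le_of_ne hF0 (Ne.symm hz)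
  have hFQ : F ^ 2 ≤ 9 * Q := by
    refine (Finset.sum_mul_sq_le_sq_mul_sq S (fun m => ww (n - m).natAbs) f).trans ?_
    exact mul_le_mul_of_nonneg_right (all_sum S n) hQ0
  set y := 36 * Q / F ^ 2 with hy
  have hy1 : 1 ≤ y := by
    rw [hy, le_div_iff₀ (by positivity)]; nlinarith
  set R := ⌊y ^ 4⌋₊ with hR
  have hR1 : y ^ 4 ≤ R + 1 := (Nat.lt_floor_add_one _).le
  have hR2 : (R + 1 : ℝ) ≤ 2 * y ^ 4 := by
    have := Nat.floor_le (a := y ^ 4) (by positivity)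
    have := one_le_pow₀ hy1 (n := 4)
    linarith
  obtain ⟨r, hrR, hr⟩ := Finset.exists_max_image (Finset.range (R + 1)) (fun r => ∑ m ∈ S, av r (n - m) * f m) ⟨0, by simp⟩
  refine ⟨r, ?_⟩
  set M := ∑ m ∈ S, av r (n - m) * f m with hM
  have hM0 : 0 ≤ M := Finset.sum_nonneg fun m _ => mul_nonneg (av_nonneg _ _) (hf m)
  have hnear := near_sum S n f M R hM0 (by
    intro s hs
    have := hr s (Finset.mem_range.2 (by omega))
    have e : ∑ m ∈ S, av s (n - m) * f m = (∑ m ∈ S with (n - m).natAbs ≤ s, f m) / (2 * s + 1) := by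
      rw [Finset.sum_filter, Finset.sum_div]
      refine Finset.sum_congr rfl fun m _ => ?_
      unfold av; split_ifs <;> ring
    rw [e, div_le_iff₀ (by positivity)] at this
    exact this)
  have hsplit := Finset.sum_filter_add_sum_filter_not S (fun m => (n - m).natAbs ≤ R) (fun m => ww (n - m).natAbs * f m)
  set N := ∑ m ∈ S with (n - m).natAbs ≤ R, ww (n - m).natAbs * f m with hN
  set W := ∑ m ∈ S with ¬ (n - m).natAbs ≤ R, ww (n - m).natAbs * f m with hW
  have hWF : W ≤ F / 2 := by
    have c : W ^ 2 ≤ _ := Finset.sum_mul_sq_le_sq_mul_sq (S.filter (fun m => ¬ (n - m).natAbs ≤ R)) (fun m => ww (n - m).natAbs) f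
    have c1 : ∑ m ∈ S with ¬ (n - m).natAbs ≤ R, f m ^ 2 ≤ Q :=
      Finset.sum_le_sum_of_subset_of_nonneg (Finset.filter_subset _ _) fun _ _ _ => sq_nonneg _
    have c2 := far_sum S n R
    have c3 : (R + 1 : ℝ) ^ (-(1 : ℝ) / 4) ≤ y⁻¹ := by
      calc (R + 1 : ℝ) ^ (-(1 : ℝ) / 4) ≤ (y ^ 4) ^ (-(1 : ℝ) / 4) :=
            Real.rpow_le_rpow_of_nonpos (by positivity) hR1 (by norm_num)
        _ = y⁻¹ := by
            rw [← Real.rpow_natCast, ← Real.rpow_mul (by positivity), ← Real.rpow_neg_one]; norm_num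
    have c4 : W ^ 2 ≤ (8 * y⁻¹) * Q := by
      refine c.trans (mul_le_mul (c2.trans ?_) c1 (Finset.sum_nonneg fun _ _ => sq_nonneg _) (by positivity))
      linarith
    have hQp : 0 < Q := by nlinarith [pow_pos hFp 2]
    have c5 : (8 * y⁻¹) * Q = 8 / 36 * F ^ 2 := by
      rw [hy]; field_simp
    refine (abs_le_of_sq_le_sq' ?_ (by positivity)).2
    nlinarith [sq_nonneg F]
  have hNF : F / 2 ≤ N := by linarith
  have hpow : ((R + 1 : ℝ) ^ ((3 : ℝ) / 8)) ^ 2 ≤ 2 * y ^ 3 := by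
    rw [← Real.rpow_natCast, ← Real.rpow_mul (by positivity)]
    calc (R + 1 : ℝ) ^ ((3 : ℝ) / 8 * (2 : ℕ)) ≤ (2 * y ^ 4) ^ ((3 : ℝ) / 8 * (2 : ℕ)) :=
          Real.rpow_le_rpow (by positivity) hR2 (by norm_num)
      _ = 2 ^ ((3 : ℝ) / 4) * y ^ 3 := by
          rw [Real.mul_rpow (by norm_num) (by positivity)]
          congr 1
          · norm_num
          · rw [← Real.rpow_natCast, ← Real.rpow_mul (by positivity), ← Real.rpow_natCast]; norm_num
      _ ≤ 2 * y ^ 3 := by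
          gcongr
          calc (2:ℝ) ^ ((3 : ℝ) / 4) ≤ 2 ^ (1:ℝ) := Real.rpow_le_rpow_of_exponent_le (by norm_num) (by norm_num)
            _ = 2 := by norm_num
  have h5 : (F / 2) ^ 2 ≤ 114 * y ^ 3 * M ^ 2 := by
    calc (F / 2) ^ 2 ≤ (M * (16 / 3 * (R + 1 : ℝ) ^ ((3 : ℝ) / 8))) ^ 2 := by
          gcongr; linarith
      _ = (16 / 3) ^ 2 * M ^ 2 * ((R + 1 : ℝ) ^ ((3 : ℝ) / 8)) ^ 2 := by ring
      _ ≤ (16 / 3) ^ 2 * M ^ 2 * (2 * y ^ 3) := by gcongr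
      _ ≤ _ := by
        have : 0 ≤ M ^ 2 * y ^ 3 := by positivity
        nlinarith
  have h6 : y ^ 3 * F ^ 6 = 36 ^ 3 * Q ^ 3 := by
    rw [hy]; field_simp
  calc F ^ 8 = 4 * (F / 2) ^ 2 * F ^ 6 := by ring
    _ ≤ 4 * (114 * y ^ 3 * M ^ 2) * F ^ 6 := by gcongr
    _ = 456 * (y ^ 3 * F ^ 6) * M ^ 2 := by ring
    _ = _ := by rw [h6]; ring

lemma finite_hls (S : Finset ℤ) (f : ℤ → ℝ) (hf : ∀ m, 0 ≤ f m) :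
    ∑ n ∈ S, (∑ m ∈ S, ww (n - m).natAbs * f m) ^ 8 ≤ 456 * 36 ^ 3 * 16 * (∑ m ∈ S, f m ^ 2) ^ 4 := by
  choose r hr using fun n => pointwise S n f hf
  have h := PB16 S r f hf
  have hQ0 : 0 ≤ ∑ m ∈ S, f m ^ 2 := Finset.sum_nonneg fun _ _ => sq_nonneg _
  calc _ ≤ ∑ n ∈ S, 456 * 36 ^ 3 * (∑ m ∈ S, f m ^ 2) ^ 3 * (∑ m ∈ S, av (r n) (n - m) * f m) ^ 2 :=
        Finset.sum_le_sum fun n _ => hr n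
    _ = 456 * 36 ^ 3 * (∑ m ∈ S, f m ^ 2) ^ 3 * ∑ n ∈ S, (∑ m ∈ S, av (r n) (n - m) * f m) ^ 2 := by
        rw [Finset.mul_sum]
    _ ≤ 456 * 36 ^ 3 * (∑ m ∈ S, f m ^ 2) ^ 3 * (16 * ∑ m ∈ S, f m ^ 2) := by gcongr
    _ = _ := by ring

/-- Discrete Sobolev embedding `‖|D_d|^{-3/8} f‖_{ℓ⁸} ≲ ‖f‖_{ℓ²}`, with `|D_d|^{-3/8}`
realized as convolution with `Ker`. -/
theorem stmt9 : ∃ C > 0, ∀ f : ℤ → ℂ, Summable (fun n : ℤ => ‖f n‖ ^ 2) →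
    (∑' n : ℤ, ‖∑' m : ℤ, Ker (n - m) * f m‖ ^ (8 : ℕ)) ^ ((1 : ℝ) / 8)
      ≤ C * (∑' n : ℤ, ‖f n‖ ^ 2) ^ ((1 : ℝ) / 2) := by
  obtain ⟨K, hK, hKer⟩ := Ker_bound
  set A : ℝ := K ^ 8 * (456 * 36 ^ 3 * 16) with hA
  have hA0 : 0 < A := by positivity
  refine ⟨A ^ ((1 : ℝ) / 8), by positivity, fun f hf => ?_⟩
  set Q := ∑' n : ℤ, ‖f n‖ ^ 2 with hQ
  have hQ0 : 0 ≤ Q := tsum_nonneg fun _ => by positivity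
  have hQS : ∀ S : Finset ℤ, ∑ m ∈ S, ‖f m‖ ^ 2 ≤ Q := fun S => hf.sum_le_tsum S fun _ _ => by positivity
  have hsum : ∀ n, Summable (fun m : ℤ => Ker (n - m) * f m) := by
    intro n
    apply Summable.of_norm
    refine summable_of_sum_le (c := K * (3 * √Q)) (fun m => norm_nonneg _) fun S => ?_
    calc ∑ m ∈ S, ‖Ker (n - m) * f m‖ ≤ ∑ m ∈ S, K * (ww (n - m).natAbs * ‖f m‖) := by
          refine Finset.sum_le_sum fun m _ => ?_
          rw [norm_mul, ← mul_assoc]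
          exact mul_le_mul_of_nonneg_right (hKer _) (norm_nonneg _)
      _ = K * ∑ m ∈ S, (ww (n - m).natAbs * ‖f m‖) := by rw [Finset.mul_sum]
      _ ≤ _ := by
          refine mul_le_mul_of_nonneg_left ?_ hK.le
          refine (abs_le_of_sq_le_sq' ?_ (by positivity)).2
          rw [mul_pow, Real.sq_sqrt hQ0]
          refine (Finset.sum_mul_sq_le_sq_mul_sq S (fun m => ww (n - m).natAbs) (fun m => ‖f m‖)).trans ?_
          exact mul_le_mul ((all_sum S n).trans (by norm_num)) (hQS S) (Finset.sum_nonneg fun _ _ => sq_nonneg _) (by norm_num)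
  have hfin : ∀ S : Finset ℤ, ∑ n ∈ S, ‖∑ m ∈ S, Ker (n - m) * f m‖ ^ 8 ≤ A * Q ^ 4 := by
    intro S
    calc ∑ n ∈ S, ‖∑ m ∈ S, Ker (n - m) * f m‖ ^ 8 ≤ ∑ n ∈ S, (K * ∑ m ∈ S, ww (n - m).natAbs * ‖f m‖) ^ 8 := by
          refine Finset.sum_le_sum fun n _ => ?_
          refine pow_le_pow_left₀ (norm_nonneg _) ?_ 8
          refine (norm_sum_le _ _).trans ?_
          rw [Finset.mul_sum]
          refine Finset.sum_le_sum fun m _ => ?_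
          rw [norm_mul, ← mul_assoc]
          exact mul_le_mul_of_nonneg_right (hKer _) (norm_nonneg _)
      _ = K ^ 8 * ∑ n ∈ S, (∑ m ∈ S, ww (n - m).natAbs * ‖f m‖) ^ 8 := by
          rw [Finset.mul_sum]
          exact Finset.sum_congr rfl fun n _ => mul_pow _ _ _
      _ ≤ K ^ 8 * (456 * 36 ^ 3 * 16 * (∑ m ∈ S, ‖f m‖ ^ 2) ^ 4) := by
          gcongr
          exact finite_hls S (fun m => ‖f m‖) fun m => norm_nonneg _
      _ ≤ K ^ 8 * (456 * 36 ^ 3 * 16 * Q ^ 4) := by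
          gcongr
          exact hQS S
      _ = _ := by rw [hA]; ring
  have hmain : ∑' n : ℤ, ‖∑' m : ℤ, Ker (n - m) * f m‖ ^ (8 : ℕ) ≤ A * Q ^ 4 := by
    refine Real.tsum_le_of_sum_le (fun n => by positivity) fun T => ?_
    have hlim : Filter.Tendsto (fun S : Finset ℤ => ∑ n ∈ T, ‖∑ m ∈ S, Ker (n - m) * f m‖ ^ 8) Filter.atTop
        (nhds (∑ n ∈ T, ‖∑' m : ℤ, Ker (n - m) * f m‖ ^ 8)) :=
      tendsto_finsetSum _ fun n _ => ((hsum n).hasSum.norm.pow 8)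
    refine le_of_tendsto hlim ?_
    filter_upwards [Filter.eventually_ge_atTop T] with S hS
    exact (Finset.sum_le_sum_of_subset_of_nonneg hS fun _ _ _ => by positivity).trans (hfin S)
  calc _ ≤ (A * Q ^ 4) ^ ((1 : ℝ) / 8) :=
        Real.rpow_le_rpow (tsum_nonneg fun _ => by positivity) hmain (by norm_num)
    _ = _ := by
        rw [Real.mul_rpow hA0.le (by positivity), ← Real.rpow_natCast Q, ← Real.rpow_mul hQ0]
        norm_num
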